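/- arXiv:1512.04069 — 2 statements merged into one kernel-verified Lean document; each statement's English description precedes it below -/
import Mathlib

section
/- Let p > 1 and let q satisfy 1/p + 1/q = 1, let σ ∈ ℝ, and let h be a nonnegative Lebesgue-measurable function on (0,∞) with k(σ) := ∫₀^∞ h(t) t^{σ-1} dt satisfying 0 < k(σ) < ∞. Let δ₁, δ₂ ∈ {−1, 1}. For i = 1, 2 let 0 ≤ aᵢ < bᵢ ≤ ∞ and let vᵢ : (aᵢ, bᵢ) → (0,∞) be differentiable with vᵢ′(s) > 0 for all s ∈ (aᵢ, bᵢ), vᵢ(s) → 0 as s → aᵢ⁺, and vᵢ(s) → ∞ as s → bᵢ⁻. Let f, g be nonnegative measurable functions on (a₁, b₁) and (a₂, b₂) respectively, such that 0 < ∫_{a₁}^{b₁} v₁(x)^{p(1−δ₁σ)−1} f(x)^p / v₁′(x)^{p−1} dx < ∞ and 0 < ∫_{a₂}^{b₂} v₂(y)^{q(1−δ₂σ)−1} g(y)^q / v₂′(y)^{q−1} dy < ∞. Then ∫_{a₂}^{b₂} ∫_{a₁}^{b₁} h(v₁(x)^{δ₁} · v₂(y)^{δ₂}) f(x) g(y)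 dx dy < k(σ) · (∫_{a₁}^{b₁} v₁(x)^{p(1−δ₁σ)−1} f(x)^p / v₁′(x)^{p−1} dx)^{1/p} · (∫_{a₂}^{b₂} v₂(y)^{q(1−δ₂σ)−1} g(y)^q / v₂′(y)^{q−1} dy)^{1/q}. -/
open MeasureTheory Set Filter

open scoped ENNReal

/-- The equality case of Young's inequality. -/
theorem ENNReal.rpow_eq_rpow_of_young_le {a b : ℝ≥0∞} (ha : a ≠ ∞) (hb : b ≠ ∞) {p q : ℝ}
    (hpq : p.HolderConjugate q)
    (h : a ^ p / ENNReal.ofReal p + b ^ q / ENNReal.ofReal q ≤ a * b) : a ^ p = b ^ q := by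
  lift a to NNReal using ha
  lift b to NNReal using hb
  have hp := hpq.pos
  have hq := hpq.symm.pos
  rw [← ENNReal.coe_rpow_of_nonneg a hp.le, ← ENNReal.coe_rpow_of_nonneg b hq.le, ENNReal.ofReal,
    ENNReal.ofReal, ← ENNReal.coe_div (by simpa using hp), ← ENNReal.coe_div (by simpa using hq),
    ← ENNReal.coe_add, ← ENNReal.coe_mul, ENNReal.coe_le_coe, ← NNReal.coe_le_coe] at h
  push_cast at h
  rw [Real.coe_toNNReal _ hp.le, Real.coe_toNNReal _ hq.le] at h
  have ha0 := a.coe_nonneg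
  have hb0 := b.coe_nonneg
  have hle := Real.young_inequality_of_nonneg ha0 hb0 hpq
  have key := (Real.geom_mean_eq_arith_mean2_weighted_iff_of_pos (inv_pos.2 hp) (inv_pos.2 hq)
    (Real.rpow_nonneg ha0 p) (Real.rpow_nonneg hb0 q) hpq.inv_add_inv_eq_one).1 (by
      rw [Real.rpow_rpow_inv ha0 hp.ne', Real.rpow_rpow_inv hb0 hq.ne']
      rw [div_eq_inv_mul, div_eq_inv_mul] at h hle
      exact le_antisymm hle h)
  rw [← ENNReal.coe_rpow_of_nonneg a hp.le, ← ENNReal.coe_rpow_of_nonneg b hq.le]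
  exact_mod_cast key

/-- The equality case of Hölder's inequality. -/
theorem ENNReal.ae_eq_of_lintegral_mul_eq_Lp_mul_Lq {α : Type*} [MeasurableSpace α]
    {μ : Measure α} {p q : ℝ} (hpq : p.HolderConjugate q) {f g : α → ℝ≥0∞}
    (hf : AEMeasurable f μ) (hg : AEMeasurable g μ)
    (hf0 : ∫⁻ x, f x ^ p ∂μ ≠ 0) (hf1 : ∫⁻ x, f x ^ p ∂μ ≠ ∞)
    (hg0 : ∫⁻ x, g x ^ q ∂μ ≠ 0) (hg1 : ∫⁻ x, g x ^ q ∂μ ≠ ∞)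
    (h : ∫⁻ x, f x * g x ∂μ = (∫⁻ x, f x ^ p ∂μ) ^ (1 / p) * (∫⁻ x, g x ^ q ∂μ) ^ (1 / q)) :
    ∀ᵐ x ∂μ, f x ^ p / (∫⁻ x, f x ^ p ∂μ) = g x ^ q / (∫⁻ x, g x ^ q ∂μ) := by
  set A := ∫⁻ x, f x ^ p ∂μ with hA
  set B := ∫⁻ x, g x ^ q ∂μ with hB
  have hp := hpq.pos
  have hq := hpq.symm.pos
  set c := (A ^ (1 / p))⁻¹ with hc
  set d := (B ^ (1 / q))⁻¹ with hd
  have hA0 : A ^ (1 / p) ≠ 0 := by simp [hf0, hf1]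
  have hA1 : A ^ (1 / p) ≠ ∞ := by simp [hf0, hf1]
  have hB0 : B ^ (1 / q) ≠ 0 := by simp [hg0, hg1]
  have hB1 : B ^ (1 / q) ≠ ∞ := by simp [hg0, hg1]
  have hcp : c ^ p = A⁻¹ := by
    rw [hc, ENNReal.inv_rpow, ← ENNReal.rpow_mul, one_div_mul_cancel hp.ne', ENNReal.rpow_one]
  have hdq : d ^ q = B⁻¹ := by
    rw [hd, ENNReal.inv_rpow, ← ENNReal.rpow_mul, one_div_mul_cancel hq.ne', ENNReal.rpow_one]
  have hfp (x) : (f x * c) ^ p = f x ^ p / A := by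
    rw [ENNReal.mul_rpow_of_nonneg _ _ hp.le, hcp, div_eq_mul_inv]
  have hgq (x) : (g x * d) ^ q = g x ^ q / B := by
    rw [ENNReal.mul_rpow_of_nonneg _ _ hq.le, hdq, div_eq_mul_inv]
  have hmul : ∫⁻ x, (f x * c) * (g x * d) ∂μ = 1 := by
    simp_rw [mul_mul_mul_comm _ c]
    rw [lintegral_mul_const'' (f := fun x ↦ f x * g x) _ (hf.mul hg), h, hc, hd, mul_mul_mul_comm,
      ENNReal.mul_inv_cancel hA0 hA1, ENNReal.mul_inv_cancel hB0 hB1, one_mul]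
  have hadd : ∫⁻ x, (f x * c) ^ p / ENNReal.ofReal p + (g x * d) ^ q / ENNReal.ofReal q ∂μ = 1 := by
    simp_rw [hfp, hgq, div_eq_mul_inv]
    rw [lintegral_add_left' (((hf.pow_const p).mul_const _).mul_const _),
      lintegral_mul_const'' _ ((hf.pow_const p).mul_const _),
      lintegral_mul_const'' _ ((hg.pow_const q).mul_const _),
      lintegral_mul_const'' _ (hf.pow_const p), lintegral_mul_const'' _ (hg.pow_const q),
      ← hA, ← hB, ENNReal.mul_inv_cancel hf0 hf1, ENNReal.mul_inv_cancel hg0 hg1, one_mul, one_mul]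
    exact hpq.inv_add_inv_ennreal
  have hae := ae_eq_of_ae_le_of_lintegral_le
    (ae_of_all μ fun x ↦ ENNReal.young_inequality (f x * c) (g x * d) hpq)
    (by simp [hmul]) (by fun_prop) (by rw [hmul, hadd])
  have hff := ae_lt_top' (hf.pow_const p) hf1
  have hgf := ae_lt_top' (hg.pow_const q) hg1
  filter_upwards [hae, hff, hgf] with x hx hfx hgx
  rw [← hfp, ← hgq]
  refine ENNReal.rpow_eq_rpow_of_young_le
    (ENNReal.mul_ne_top ?_ (ENNReal.inv_ne_top.2 hA0))
    (ENNReal.mul_ne_top ?_ (ENNReal.inv_ne_top.2 hB0)) hpq hx.ge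
  · exact ((ENNReal.rpow_lt_top_iff_of_pos hp).1 hfx).ne
  · exact ((ENNReal.rpow_lt_top_iff_of_pos hq).1 hgx).ne

theorem lintegral_eq_zero_of_ae_periodic {φ : ℝ → ℝ≥0∞} {c : ℝ} (hc : 0 < c)
    (hper : ∀ᵐ x, φ x = φ (x + c)) (hfin : ∫⁻ x, φ x ≠ ∞) : ∫⁻ x, φ x = 0 := by
  set A : ℤ → ℝ≥0∞ := fun n ↦ ∫⁻ x in Ioc ((n : ℝ) * c) ((n + 1 : ℝ) * c), φ x with hA
  have hstep (n : ℤ) : A n = A (n + 1) := by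
    simp only [hA]
    rw [← lintegral_indicator measurableSet_Ioc, ← lintegral_indicator measurableSet_Ioc,
      ← lintegral_add_right_eq_self (indicator (Ioc (((n + 1 : ℤ) : ℝ) * c) _) φ) c]
    refine (lintegral_congr_ae ?_).symm
    filter_upwards [hper] with x hx
    have : x + c ∈ Ioc (((n + 1 : ℤ) : ℝ) * c) (((n + 1 : ℤ) + 1 : ℝ) * c) ↔
        x ∈ Ioc ((n : ℝ) * c) ((n + 1 : ℝ) * c) := by
      push_cast
      simp only [mem_Ioc]
      constructor <;> rintro ⟨h₁, h₂⟩ <;> constructor <;> linarith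
    simp only [indicator, this, hx]
  have hconst (n : ℤ) : A n = A 0 := by
    induction n using Int.induction_on with
    | zero => rfl
    | succ n ih => rw [← hstep, ih]
    | pred n ih => rw [hstep, sub_add_cancel, ih]
  have hsum : ∫⁻ x, φ x = ∑' n : ℤ, A n := by
    have hU : ⋃ n : ℤ, Ioc ((n : ℝ) * c) ((n + 1 : ℝ) * c) = univ := by
      simpa using iUnion_Ioc_add_zsmul hc 0
    rw [← setLIntegral_univ, ← hU, lintegral_iUnion (fun _ ↦ measurableSet_Ioc)]
    simpa using pairwise_disjoint_Ioc_add_zsmul (0 : ℝ) c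
  simp_rw [hsum, hconst] at hfin ⊢
  by_contra hne
  exact hfin (ENNReal.tsum_const_eq_top_of_ne_zero fun h0 ↦ hne (by simp [h0]))

/-- Strict Young convolution inequality on the line. -/
theorem lintegral_lintegral_add_mul_lt {p q : ℝ} (hpq : p.HolderConjugate q)
    {H F G : ℝ → ℝ≥0∞} (hH : Measurable H) (hF : Measurable F) (hG : Measurable G)
    (hH0 : ∫⁻ x, H x ≠ 0) (hH1 : ∫⁻ x, H x ≠ ∞)
    (hF0 : ∫⁻ x, F x ^ p ≠ 0) (hF1 : ∫⁻ x, F x ^ p ≠ ∞)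
    (hG0 : ∫⁻ x, G x ^ q ≠ 0) (hG1 : ∫⁻ x, G x ^ q ≠ ∞) :
    ∫⁻ t, ∫⁻ s, H (s + t) * F s * G t <
      (∫⁻ x, H x) * (∫⁻ x, F x ^ p) ^ (1 / p) * (∫⁻ x, G x ^ q) ^ (1 / q) := by
  set I : ℝ → ℝ≥0∞ := fun r ↦ ∫⁻ t, F (r - t) * G t with hI
  have hp := hpq.pos
  have hq := hpq.symm.pos
  have hswap : ∫⁻ t, ∫⁻ s, H (s + t) * F s * G t = ∫⁻ r, H r * I r := by
    calc ∫⁻ t, ∫⁻ s, H (s + t) * F s * G t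
        = ∫⁻ t, ∫⁻ r, H r * (F (r - t) * G t) := by
          refine lintegral_congr fun t ↦ ?_
          rw [← lintegral_add_right_eq_self (fun r ↦ H r * (F (r - t) * G t)) t]
          simp [mul_assoc]
      _ = ∫⁻ r, ∫⁻ t, H r * (F (r - t) * G t) := by
          refine lintegral_lintegral_swap (Measurable.aemeasurable ?_)
          simp only [Function.uncurry_def]
          fun_prop
      _ = ∫⁻ r, H r * I r := by
          refine lintegral_congr fun r ↦ ?_
          rw [lintegral_const_mul _ (by fun_prop)]
  have hshift (r : ℝ) : ∫⁻ t, F (r - t) ^ p = ∫⁻ x, F x ^ p :=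
    lintegral_sub_left_eq_self (fun x ↦ F x ^ p) r
  set A := ∫⁻ x, F x ^ p with hA
  set B := ∫⁻ x, G x ^ q with hB
  set C := A ^ (1 / p) * B ^ (1 / q) with hC
  have hC1 : C ≠ ∞ := ENNReal.mul_ne_top (by simp [hF0, hF1]) (by simp [hG0, hG1])
  have hIC (r : ℝ) : I r ≤ C := by
    have := ENNReal.lintegral_mul_le_Lp_mul_Lq volume hpq
      (f := fun t ↦ F (r - t)) (g := G) (by fun_prop) (by fun_prop)
    rwa [hshift] at this
  have hHI : ∫⁻ r, H r * C = (∫⁻ x, H x) * C := lintegral_mul_const _ hH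
  have hle : ∀ r, H r * I r ≤ H r * C := fun r ↦ by gcongr; exact hIC r
  rw [hswap, mul_assoc, ← hC, ← hHI]
  refine lt_of_le_of_ne (lintegral_mono hle) fun heq ↦ ?_
  have hae := ae_eq_of_ae_le_of_lintegral_le (ae_of_all _ hle)
    (by rw [heq, hHI]; exact ENNReal.mul_ne_top hH1 hC1) (by fun_prop) heq.ge
  obtain ⟨r₁, r₂, hr, h₁, h₂⟩ : ∃ r₁ r₂, r₁ < r₂ ∧ I r₁ = C ∧ I r₂ = C := by
    by_contra! hcon
    have hsub : {r | I r = C}.Subsingleton := by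
      intro x hx y hy
      rcases lt_trichotomy x y with hxy | hxy | hxy
      · exact (hcon x y hxy hx hy).elim
      · exact hxy
      · exact (hcon y x hxy hy hx).elim
    have hnull : ∀ᵐ r, I r ≠ C := by
      rw [ae_iff]
      simpa using hsub.measure_zero volume
    refine hH0 ((lintegral_eq_zero_iff hH).2 ?_)
    filter_upwards [hae, hnull, ae_lt_top hH hH1] with r hr hr' hrt
    by_contra hne
    exact hr' ((ENNReal.mul_right_inj hne hrt.ne).1 hr)
  have hext {r : ℝ} (h : I r = C) : ∀ᵐ t, F (r - t) ^ p / A = G t ^ q / B := by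
    have := ENNReal.ae_eq_of_lintegral_mul_eq_Lp_mul_Lq (μ := volume) hpq
      (f := fun t ↦ F (r - t)) (g := G) (by fun_prop) (by fun_prop)
      (by rwa [hshift]) (by rwa [hshift]) hG0 hG1 (by rw [hshift]; exact h)
    rwa [hshift] at this
  have hper : ∀ᵐ t, F (r₁ - t) ^ p = F (r₂ - t) ^ p := by
    filter_upwards [hext h₁, hext h₂] with t ht₁ ht₂
    have := ht₁.trans ht₂.symm
    rw [div_eq_mul_inv, div_eq_mul_inv] at this
    exact (ENNReal.mul_left_inj (ENNReal.inv_ne_zero.2 hF1) (ENNReal.inv_ne_top.2 hF0)).1 this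
  refine hF0 (lintegral_eq_zero_of_ae_periodic (sub_pos.2 hr) ?_ hF1)
  filter_upwards [(quasiMeasurePreserving_sub_left volume r₁).ae hper] with x hx
  rw [sub_sub_cancel] at hx
  rw [hx]
  congr 2
  ring

theorem exists_coe_mem_of_mem_comap_nhdsGT {a b : EReal} (hab : a < b) {T : Set ℝ}
    (hT : T ∈ Filter.comap (fun x : ℝ => (x : EReal)) (nhdsWithin a (Ioi a))) :
    ∃ x : ℝ, a < x ∧ (x : EReal) < b ∧ x ∈ T := by
  obtain ⟨U, hU, hUT⟩ := Filter.mem_comap.1 hT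
  have := nhdsGT_neBot_of_exists_gt ⟨b, hab⟩
  obtain ⟨y, hyU, hay, hyb⟩ := Filter.nonempty_of_mem (inter_mem hU (Ioo_mem_nhdsGT hab))
  lift y to ℝ using ⟨hyb.ne_top, hay.ne_bot⟩
  exact ⟨y, hay, hyb, hUT hyU⟩

theorem exists_coe_mem_of_mem_comap_nhdsLT {a b : EReal} (hab : a < b) {T : Set ℝ}
    (hT : T ∈ Filter.comap (fun x : ℝ => (x : EReal)) (nhdsWithin b (Iio b))) :
    ∃ x : ℝ, a < x ∧ (x : EReal) < b ∧ x ∈ T := by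
  obtain ⟨U, hU, hUT⟩ := Filter.mem_comap.1 hT
  have := nhdsLT_neBot_of_exists_lt ⟨a, hab⟩
  obtain ⟨y, hyU, hay, hyb⟩ := Filter.nonempty_of_mem (inter_mem hU (Ioo_mem_nhdsLT hab))
  lift y to ℝ using ⟨hyb.ne_top, hay.ne_bot⟩
  exact ⟨y, hay, hyb, hUT hyU⟩

/-- The substitution `v x = exp (δ * s)`, with `δ = ±1`, as a change of variables on an open
interval mapped increasingly by `v` onto the half-line. -/
theorem exists_exp_substitution {a b : EReal} (hab : a < b) {S : Set ℝ}
    (hS : S = {x : ℝ | a < (x : EReal) ∧ (x : EReal) < b}) {v v' : ℝ → ℝ}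
    (hvd : ∀ s ∈ S, HasDerivAt v (v' s) s) (hv' : ∀ s ∈ S, 0 < v' s) (hv0 : ∀ s ∈ S, 0 < v s)
    (hva : Tendsto v (Filter.comap (fun x : ℝ => (x : EReal)) (nhdsWithin a (Ioi a)))
      (nhds (0 : ℝ)))
    (hvb : Tendsto v (Filter.comap (fun x : ℝ => (x : EReal)) (nhdsWithin b (Iio b))) atTop)
    {δ : ℤ} (hδ : δ = -1 ∨ δ = 1) :
    ∃ ψ w : ℝ → ℝ, Measurable ψ ∧ Measurable w ∧ (∀ s, ψ s ∈ S) ∧ (∀ s, v' (ψ s) = w s) ∧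
      (∀ s, 0 < w s) ∧ (∀ s, v (ψ s) = Real.exp (δ * s)) ∧
      ∀ φ : ℝ → ℝ≥0∞, ∫⁻ x in S, φ x =
        ∫⁻ s, φ (ψ s) * ENNReal.ofReal (Real.exp (δ * s) / w s) := by
  have hδδ : (δ : ℝ) * δ = 1 := by rcases hδ with rfl | rfl <;> norm_num
  have hδabs : |(δ : ℝ)| = 1 := by rcases hδ with rfl | rfl <;> norm_num
  have hSo : IsOpen S := by
    rw [hS]
    exact (isOpen_Ioo (a := a) (b := b)).preimage continuous_coe_real_ereal
  have hSc : S.OrdConnected := by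
    refine ⟨fun x hx y hy z hz ↦ ?_⟩
    rw [hS] at hx hy ⊢
    exact ⟨hx.1.trans_le (EReal.coe_le_coe hz.1), (EReal.coe_le_coe hz.2).trans_lt hy.2⟩
  have hvc : ContinuousOn v S := fun s hs ↦ (hvd s hs).continuousAt.continuousWithinAt
  have hmono : StrictMonoOn v S := by
    refine strictMonoOn_of_deriv_pos hSc.convex hvc fun x hx ↦ ?_
    have hx := interior_subset hx
    rw [(hvd x hx).deriv]
    exact hv' x hx
  have hsurj (y : ℝ) (hy : 0 < y) : ∃ x ∈ S, v x = y := by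
    obtain ⟨l, hal, hlb, hl⟩ := exists_coe_mem_of_mem_comap_nhdsGT hab (hva.eventually_lt_const hy)
    obtain ⟨u, hau, hub, hu⟩ :=
      exists_coe_mem_of_mem_comap_nhdsLT hab (hvb.eventually_gt_atTop y)
    have hlS : l ∈ S := by rw [hS]; exact ⟨hal, hlb⟩
    have huS : u ∈ S := by rw [hS]; exact ⟨hau, hub⟩
    exact hSc.isPreconnected.intermediate_value hlS huS hvc ⟨le_of_lt hl, le_of_lt hu⟩
  choose χ hχS hχv using fun s : ℝ ↦ hsurj (Real.exp s) (Real.exp_pos s)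
  have hχmono : Monotone χ := by
    intro s t hst
    by_contra! hlt
    have := hmono (hχS t) (hχS s) hlt
    rw [hχv, hχv, Real.exp_lt_exp] at this
    exact this.not_ge hst
  have hχm := hχmono.measurable
  have hχw (s : ℝ) : v' (χ s) = deriv v (χ s) := (hvd _ (hχS s)).deriv.symm
  have hinv (x : ℝ) (hx : x ∈ S) : χ (Real.log (v x)) = x := by
    apply hmono.injOn (hχS _) hx
    rw [hχv, Real.exp_log (hv0 x hx)]
  refine ⟨fun s ↦ χ (δ * s), fun s ↦ deriv v (χ (δ * s)), by fun_prop,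
    (measurable_deriv v).comp (by fun_prop), fun s ↦ hχS _, fun s ↦ hχw _,
    fun s ↦ (hv' _ (hχS _)).trans_eq (hχw _), fun s ↦ hχv _, fun φ ↦ ?_⟩
  have hL (x : ℝ) (hx : x ∈ S) : (δ : ℝ) * (δ * Real.log (v x)) = Real.log (v x) := by
    rw [← mul_assoc, hδδ, one_mul]
  have himage : (fun x ↦ (δ : ℝ) * Real.log (v x)) '' S = univ := by
    refine eq_univ_of_forall fun s ↦ ⟨χ (δ * s), hχS _, ?_⟩
    simp only [hχv, Real.log_exp, ← mul_assoc, hδδ, one_mul]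
  have hinj : InjOn (fun x ↦ (δ : ℝ) * Real.log (v x)) S := by
    intro x hx y hy hxy
    rw [← hinv x hx, ← hinv y hy, ← hL x hx, ← hL y hy]
    exact congrArg (fun r ↦ χ (δ * r)) hxy
  rw [← setLIntegral_univ (fun s ↦ φ (χ (δ * s)) * _), ← himage,
    lintegral_image_eq_lintegral_abs_deriv_mul hSo.measurableSet
      (fun x hx ↦ (((hvd x hx).log (hv0 x hx).ne').const_mul (δ : ℝ)).hasDerivWithinAt) hinj]
  refine setLIntegral_congr_fun hSo.measurableSet fun x hx ↦ ?_
  have hvx := hv0 x hx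
  have hv'x := hv' x hx
  simp only [hL x hx, hinv x hx, Real.exp_log hvx, (hvd x hx).deriv]
  rw [mul_left_comm, ← ENNReal.ofReal_mul (abs_nonneg _), abs_mul, hδabs, one_mul,
    abs_of_pos (div_pos hv'x hvx), div_mul_div_cancel₀ hvx.ne', div_self hv'x.ne',
    ENNReal.ofReal_one, mul_one]

theorem lintegral_Ioi_eq_lintegral_exp (h : ℝ → ℝ) (σ : ℝ) :
    ∫⁻ t in Ioi (0 : ℝ), ENNReal.ofReal (h t * t ^ (σ - 1)) =
      ∫⁻ s, ENNReal.ofReal (h (Real.exp s) * Real.exp (σ * s)) := by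
  rw [← Real.range_exp, ← image_univ, lintegral_image_eq_lintegral_abs_deriv_mul MeasurableSet.univ
    (fun x _ ↦ (Real.hasDerivAt_exp x).hasDerivWithinAt) Real.exp_injective.injOn,
    setLIntegral_univ]
  refine lintegral_congr fun s ↦ ?_
  rw [← ENNReal.ofReal_mul (abs_nonneg _), abs_of_pos (Real.exp_pos s), mul_left_comm,
    ← Real.exp_mul, ← Real.exp_add]
  ring_nf

theorem weighted_rpow_eq_rpow_exp {p σ δ s f w : ℝ} (hp : 0 < p) (hδ : δ * δ = 1) (hf : 0 ≤ f)
    (hw : 0 < w) :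
    ENNReal.ofReal (Real.exp (δ * s) ^ (p * (1 - δ * σ) - 1) * f ^ p / w ^ (p - 1)) *
        ENNReal.ofReal (Real.exp (δ * s) / w) =
      ENNReal.ofReal (f * (Real.exp (δ * s) / w) * Real.exp (-(σ * s))) ^ p := by
  rw [← ENNReal.ofReal_mul (by positivity), ENNReal.ofReal_rpow_of_nonneg (by positivity) hp.le]
  congr 1
  rw [Real.mul_rpow (by positivity) (by positivity), Real.mul_rpow hf (by positivity),
    Real.div_rpow (by positivity) hw.le, ← Real.exp_mul, ← Real.exp_mul, ← Real.exp_mul,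
    Real.rpow_sub_one hw.ne']
  have hexp : Real.exp (δ * s * (p * (1 - δ * σ) - 1)) * Real.exp (δ * s) =
      Real.exp (δ * s * p) * Real.exp (-(σ * s) * p) := by
    rw [← Real.exp_add, ← Real.exp_add]
    congr 1
    linear_combination (-(s * p * σ)) * hδ
  generalize Real.exp (-(σ * s) * p) = E at hexp ⊢
  field_simp
  linear_combination (f ^ p) * hexp

/-- Yang–Hilbert-type integral inequality in the first quadrant with multi-variables:
for strictly increasing differentiable substitutions `vᵢ : (aᵢ,bᵢ) → (0,∞)` with
`vᵢ(aᵢ⁺) = 0`, `vᵢ(bᵢ⁻) = ∞`, and `δᵢ ∈ {-1,1}`,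
`∫∫ h(v₁(x)^{δ₁} v₂(y)^{δ₂}) f(x) g(y) dx dy
  < k(σ) (∫ v₁^{p(1-δ₁σ)-1} f^p / v₁'^{p-1})^{1/p} (∫ v₂^{q(1-δ₂σ)-1} g^q / v₂'^{q-1})^{1/q}`. -/
theorem stmt7 (p q σ : ℝ) (hp : 1 < p) (hpq : 1 / p + 1 / q = 1)
    (h : ℝ → ℝ) (hh : Measurable h) (hh0 : ∀ t ∈ Ioi (0 : ℝ), 0 ≤ h t)
    (hk0 : 0 < ∫⁻ t in Ioi (0 : ℝ), ENNReal.ofReal (h t * t ^ (σ - 1)))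
    (hk1 : (∫⁻ t in Ioi (0 : ℝ), ENNReal.ofReal (h t * t ^ (σ - 1))) < ⊤)
    (δ₁ δ₂ : ℤ) (hδ₁ : δ₁ = -1 ∨ δ₁ = 1) (hδ₂ : δ₂ = -1 ∨ δ₂ = 1)
    (a₁ b₁ a₂ b₂ : EReal) (ha₁ : 0 ≤ a₁) (hab₁ : a₁ < b₁) (ha₂ : 0 ≤ a₂) (hab₂ : a₂ < b₂)
    (S₁ S₂ : Set ℝ)
    (hS₁ : S₁ = {x : ℝ | a₁ < (x : EReal) ∧ (x : EReal) < b₁})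
    (hS₂ : S₂ = {y : ℝ | a₂ < (y : EReal) ∧ (y : EReal) < b₂})
    (v₁ v₂ v₁' v₂' : ℝ → ℝ)
    (hv₁d : ∀ s ∈ S₁, HasDerivAt v₁ (v₁' s) s) (hv₁' : ∀ s ∈ S₁, 0 < v₁' s)
    (hv₂d : ∀ s ∈ S₂, HasDerivAt v₂ (v₂' s) s) (hv₂' : ∀ s ∈ S₂, 0 < v₂' s)
    (hv₁pos : ∀ s ∈ S₁, 0 < v₁ s) (hv₂pos : ∀ s ∈ S₂, 0 < v₂ s)
    (hv₁a : Tendsto v₁ (Filter.comap (fun x : ℝ => (x : EReal)) (nhdsWithin a₁ (Ioi a₁)))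
      (nhds (0 : ℝ)))
    (hv₁b : Tendsto v₁ (Filter.comap (fun x : ℝ => (x : EReal)) (nhdsWithin b₁ (Iio b₁)))
      atTop)
    (hv₂a : Tendsto v₂ (Filter.comap (fun y : ℝ => (y : EReal)) (nhdsWithin a₂ (Ioi a₂)))
      (nhds (0 : ℝ)))
    (hv₂b : Tendsto v₂ (Filter.comap (fun y : ℝ => (y : EReal)) (nhdsWithin b₂ (Iio b₂)))
      atTop)
    (f g : ℝ → ℝ) (hf : Measurable f) (hg : Measurable g)
    (hf0 : ∀ x ∈ S₁, 0 ≤ f x) (hg0 : ∀ y ∈ S₂, 0 ≤ g y)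
    (hA0 : 0 < ∫⁻ x in S₁,
      ENNReal.ofReal (v₁ x ^ (p * (1 - (δ₁ : ℝ) * σ) - 1) * f x ^ p / v₁' x ^ (p - 1)))
    (hA1 : (∫⁻ x in S₁,
      ENNReal.ofReal (v₁ x ^ (p * (1 - (δ₁ : ℝ) * σ) - 1) * f x ^ p / v₁' x ^ (p - 1))) < ⊤)
    (hB0 : 0 < ∫⁻ y in S₂,
      ENNReal.ofReal (v₂ y ^ (q * (1 - (δ₂ : ℝ) * σ) - 1) * g y ^ q / v₂' y ^ (q - 1)))
    (hB1 : (∫⁻ y in S₂,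
      ENNReal.ofReal (v₂ y ^ (q * (1 - (δ₂ : ℝ) * σ) - 1) * g y ^ q / v₂' y ^ (q - 1))) < ⊤) :
    (∫⁻ y in S₂, ∫⁻ x in S₁, ENNReal.ofReal (h (v₁ x ^ δ₁ * v₂ y ^ δ₂) * f x * g y))
      < (∫⁻ t in Ioi (0 : ℝ), ENNReal.ofReal (h t * t ^ (σ - 1))) *
          (∫⁻ x in S₁,
            ENNReal.ofReal (v₁ x ^ (p * (1 - (δ₁ : ℝ) * σ) - 1) * f x ^ p /
              v₁' x ^ (p - 1))) ^ (1 / p) *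
          (∫⁻ y in S₂,
            ENNReal.ofReal (v₂ y ^ (q * (1 - (δ₂ : ℝ) * σ) - 1) * g y ^ q /
              v₂' y ^ (q - 1))) ^ (1 / q) := by
  have hconj : p.HolderConjugate q := by
    rw [Real.holderConjugate_iff]
    exact ⟨hp, by simpa [one_div] using hpq⟩
  have hδδ₁ : (δ₁ : ℝ) * δ₁ = 1 := by rcases hδ₁ with rfl | rfl <;> norm_num
  have hδδ₂ : (δ₂ : ℝ) * δ₂ = 1 := by rcases hδ₂ with rfl | rfl <;> norm_num
  have hzpow {δ : ℤ} (hδ : δ = -1 ∨ δ = 1) (s : ℝ) : Real.exp (δ * s) ^ δ = Real.exp s := by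
    rcases hδ with rfl | rfl <;> simp [Real.exp_neg]
  obtain ⟨ψ₁, w₁, hψ₁, hw₁, hψS₁, hv'₁, hw0₁, hvψ₁, hsub₁⟩ :=
    exists_exp_substitution hab₁ hS₁ hv₁d hv₁' hv₁pos hv₁a hv₁b hδ₁
  obtain ⟨ψ₂, w₂, hψ₂, hw₂, hψS₂, hv'₂, hw0₂, hvψ₂, hsub₂⟩ :=
    exists_exp_substitution hab₂ hS₂ hv₂d hv₂' hv₂pos hv₂a hv₂b hδ₂
  have hF0 (s : ℝ) := hf0 _ (hψS₁ s)
  have hG0 (t : ℝ) := hg0 _ (hψS₂ t)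
  have hA := hsub₁ fun x ↦
    ENNReal.ofReal (v₁ x ^ (p * (1 - (δ₁ : ℝ) * σ) - 1) * f x ^ p / v₁' x ^ (p - 1))
  have hB := hsub₂ fun y ↦
    ENNReal.ofReal (v₂ y ^ (q * (1 - (δ₂ : ℝ) * σ) - 1) * g y ^ q / v₂' y ^ (q - 1))
  simp only [hvψ₁, hv'₁, weighted_rpow_eq_rpow_exp hconj.pos hδδ₁ (hF0 _) (hw0₁ _)] at hA
  simp only [hvψ₂, hv'₂, weighted_rpow_eq_rpow_exp hconj.symm.pos hδδ₂ (hG0 _) (hw0₂ _)] at hB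
  rw [hA] at hA0 hA1 ⊢
  rw [hB] at hB0 hB1 ⊢
  rw [lintegral_Ioi_eq_lintegral_exp] at hk0 hk1 ⊢
  refine lt_of_eq_of_lt ?_ (lintegral_lintegral_add_mul_lt hconj (by fun_prop) (by fun_prop)
    (by fun_prop) hk0.ne' hk1.ne hA0.ne' hA1.ne hB0.ne' hB1.ne)
  rw [hsub₂]
  refine lintegral_congr fun t ↦ ?_
  rw [hsub₁, ← lintegral_mul_const' _ _ ENNReal.ofReal_ne_top]
  refine lintegral_congr fun s ↦ ?_
  have hH0 := hh0 _ (Real.exp_pos (s + t))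
  have hf0s := hF0 s
  have hg0t := hG0 t
  have hw0s := hw0₁ s
  have hw0t := hw0₂ t
  rw [hvψ₁, hvψ₂, hzpow hδ₁, hzpow hδ₂, ← Real.exp_add, ← ENNReal.ofReal_mul (by positivity),
    ← ENNReal.ofReal_mul (by positivity), ← ENNReal.ofReal_mul (by positivity),
    ← ENNReal.ofReal_mul (by positivity)]
  congr 1
  have hexp : Real.exp (σ * (s + t)) * Real.exp (-(σ * s)) * Real.exp (-(σ * t)) = 1 := by
    rw [← Real.exp_add, ← Real.exp_add, Real.exp_eq_one_iff]
    ring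
  linear_combination (-(h (Real.exp (s + t)) * f (ψ₁ s) * (Real.exp (δ₁ * s) / w₁ s) *
    g (ψ₂ t) * (Real.exp (δ₂ * t) / w₂ t))) * hexp
end

section
/- Let p > 1 and let q satisfy 1/p + 1/q = 1, let μ, σ ∈ ℝ with μ + σ = λ, and let k_λ be a nonnegative measurable function on (0,∞)×(0,∞) that is homogeneous of degree −λ, with k_λ(σ) := ∫₀^∞ k_λ(1,t) t^{σ-1} dt satisfying 0 < k_λ(σ) < ∞. Let f be a nonnegative measurable function on (0,∞) such that 0 < ∫₀^∞ x^{p(1−μ)−1} f(x)^p dx < ∞. Then ∫₀^∞ y^{pσ−1} (∫₀^∞ k_λ(x,y) f(x) dx)^p dy < k_λ(σ)^p · ∫₀^∞ x^{p(1−μ)−1} f(x)^p dx. -/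
open MeasureTheory Set

/-- Strict Jensen inequality for `x ↦ x ^ p` and a finite measure, in terms of `lintegral`. -/
theorem ae_eq_const_or_lintegral_rpow_lt {α : Type*} [MeasurableSpace α] {ν : Measure α}
    [IsFiniteMeasure ν] (hν : ν ≠ 0) {p : ℝ} (hp : 1 < p) {g : α → ℝ} (hg : Measurable g)
    (hg0 : ∀ s, 0 ≤ g s) (hfin : ∫⁻ s, ENNReal.ofReal (g s) ^ p ∂ν ≠ ⊤) :
    (∀ᵐ s ∂ν, ENNReal.ofReal (g s) = (∫⁻ r, ENNReal.ofReal (g r) ∂ν) / ν univ) ∨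
      (∫⁻ s, ENNReal.ofReal (g s) ∂ν) ^ p <
        ν univ ^ (p - 1) * ∫⁻ s, ENNReal.ofReal (g s) ^ p ∂ν := by
  have hp0 : 0 < p := by linarith
  have hpow : ∀ s, ENNReal.ofReal (g s) ^ p = ENNReal.ofReal (g s ^ p) := fun s =>
    ENNReal.ofReal_rpow_of_nonneg (hg0 s) hp0.le
  simp only [hpow] at hfin ⊢
  have hgp0 : ∀ s, 0 ≤ g s ^ p := fun s => Real.rpow_nonneg (hg0 s) p
  have hgp : Integrable (fun s => g s ^ p) ν :=
    (lintegral_ofReal_ne_top_iff_integrable (hg.pow_const p).aestronglyMeasurable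
      (Filter.Eventually.of_forall hgp0)).1 hfin
  have hgi : Integrable g ν := by
    refine ((integrable_const (1 : ℝ)).add hgp).mono' hg.aestronglyMeasurable
      (Filter.Eventually.of_forall fun s => ?_)
    simp only [Real.norm_eq_abs, abs_of_nonneg (hg0 s), Pi.add_apply]
    rcases le_total (g s) 1 with h | h
    · linarith [hgp0 s]
    · have := Real.self_le_rpow_of_one_le h hp.le
      linarith
  rw [← ofReal_integral_eq_lintegral_ofReal hgi (Filter.Eventually.of_forall hg0),
    ← ofReal_integral_eq_lintegral_ofReal hgp (Filter.Eventually.of_forall hgp0)]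
  have hW : 0 < ν.real univ := by
    rw [Measure.real, ENNReal.toReal_pos_iff]
    exact ⟨(Measure.measure_univ_pos).2 hν, measure_lt_top _ _⟩
  have hWe : ν univ = ENNReal.ofReal (ν.real univ) := by simp
  rw [hWe]
  have hI : 0 ≤ ∫ s, g s ∂ν := integral_nonneg hg0
  rcases (strictConvexOn_rpow hp).ae_eq_const_or_map_average_lt
    (Real.continuous_rpow_const hp0.le).continuousOn isClosed_Ici
    (Filter.Eventually.of_forall hg0) hgi hgp with h | h
  · left
    filter_upwards [h] with s hs
    rw [hs, Function.const_apply, average_eq, smul_eq_mul, ← ENNReal.ofReal_div_of_pos hW,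
      inv_mul_eq_div]
  · right
    rw [average_eq, average_eq, smul_eq_mul, smul_eq_mul, Real.mul_rpow (by positivity) hI,
      Real.inv_rpow hW.le, inv_mul_lt_iff₀ (by positivity)] at h
    rw [ENNReal.ofReal_rpow_of_nonneg hI hp0.le, ENNReal.ofReal_rpow_of_pos hW,
      ← ENNReal.ofReal_mul (by positivity), Real.rpow_sub_one hW.ne']
    have hlt : (∫ s, g s ∂ν) ^ p < ν.real univ ^ p / ν.real univ * ∫ s, g s ^ p ∂ν := by
      calc _ < _ := h
        _ = _ := by ring
    exact (ENNReal.ofReal_lt_ofReal_iff_of_nonneg (by positivity)).2 hlt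

/-- A periodic function with finite integral over the line has zero integral. -/
theorem lintegral_eq_zero_of_ae_periodic_s10 {g : ℝ → ENNReal}
    (hfin : ∫⁻ t, g t ≠ ⊤) {d : ℝ} (hd : 0 < d) (hper : ∀ᵐ t, g (t - d) = g t) :
    ∫⁻ t, g t = 0 := by
  have hIoc : ∀ a : ℝ, ∫⁻ t in Ioc a (a + d), g t = 0 := by
    intro a
    have hshift : ∫⁻ t in Iic (a + d), g t = ∫⁻ t in Iic a, g t := by
      rw [← lintegral_indicator measurableSet_Iic, ← lintegral_indicator measurableSet_Iic,
        ← lintegral_sub_right_eq_self ((Iic a).indicator g) d]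
      refine lintegral_congr_ae ?_
      filter_upwards [hper] with t ht
      by_cases h : t ≤ a + d
      · simp [indicator, h, ht]
      · simp [indicator, h]
    have hsplit : ∫⁻ t in Iic (a + d), g t =
        (∫⁻ t in Iic a, g t) + ∫⁻ t in Ioc a (a + d), g t := by
      rw [← lintegral_union measurableSet_Ioc (Iic_disjoint_Ioc le_rfl),
        Iic_union_Ioc_eq_Iic (by linarith)]
    have hne : ∫⁻ t in Iic a, g t ≠ ⊤ := ne_top_of_le_ne_top hfin (setLIntegral_le_lintegral _ _)
    rw [hshift] at hsplit
    exact (ENNReal.add_right_inj hne).1 (by rw [← hsplit, add_zero])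
  rw [← setLIntegral_univ, ← iUnion_Ioc_add_zsmul hd 0]
  refine le_antisymm ((lintegral_iUnion_le _ _).trans ?_) zero_le
  simp only [nonpos_iff_eq_zero, ENNReal.tsum_eq_zero]
  intro n
  have h := hIoc (0 + n • d)
  rwa [add_assoc, ← add_one_zsmul] at h

/-- Strict form of Young's convolution inequality `L¹ * Lᵖ ⊆ Lᵖ` on the line. -/
theorem lintegral_convolution_rpow_lt {p : ℝ} (hp : 1 < p) {w : ℝ → ENNReal} (hw : Measurable w)
    {φ : ℝ → ℝ} (hφ : Measurable φ) (hφ0 : ∀ t, 0 ≤ φ t)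
    (hw0 : ∫⁻ s, w s ≠ 0) (hw1 : ∫⁻ s, w s ≠ ⊤)
    (h0 : ∫⁻ t, ENNReal.ofReal (φ t) ^ p ≠ 0) (h1 : ∫⁻ t, ENNReal.ofReal (φ t) ^ p ≠ ⊤) :
    ∫⁻ t, (∫⁻ s, w s * ENNReal.ofReal (φ (t - s))) ^ p <
      (∫⁻ s, w s) ^ p * ∫⁻ t, ENNReal.ofReal (φ t) ^ p := by
  have hp0 : 0 < p := by linarith
  set ν : Measure ℝ := volume.withDensity w with hνdef
  set Φ : ℝ → ENNReal := fun t => ENNReal.ofReal (φ t)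
  have hΦ : Measurable Φ := hφ.ennreal_ofReal
  have hνu : ν univ = ∫⁻ s, w s := by rw [hνdef, withDensity_apply _ .univ, setLIntegral_univ]
  have : IsFiniteMeasure ν := ⟨by rw [hνu]; exact hw1.lt_top⟩
  have hν0 : ν ≠ 0 := by
    intro h
    rw [← hνu, h] at hw0
    exact hw0 rfl
  have hνint : ∀ g : ℝ → ENNReal, Measurable g → ∫⁻ s, w s * g s = ∫⁻ s, g s ∂ν := fun g hg =>
    (lintegral_withDensity_eq_lintegral_mul _ hw hg).symm
  have hsub : Measurable fun z : ℝ × ℝ => Φ (z.1 - z.2) := hΦ.comp measurable_sub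
  have hsub' : ∀ t, Measurable fun s => Φ (t - s) := fun t =>
    hΦ.comp (measurable_const.sub measurable_id)
  rw [← hνu]
  have hL : (fun t => (∫⁻ s, w s * Φ (t - s)) ^ p) = fun t => (∫⁻ s, Φ (t - s) ∂ν) ^ p := by
    ext t
    rw [hνint _ (hsub' t)]
  change ∫⁻ t, (∫⁻ s, w s * Φ (t - s)) ^ p < ν univ ^ p * ∫⁻ t, Φ t ^ p
  rw [hL]
  have hpow : ν univ ^ (p - 1) * ν univ = ν univ ^ p := by
    conv_lhs => enter [2]; rw [← ENNReal.rpow_one (ν univ)]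
    rw [← ENNReal.rpow_add _ _ (by simpa using hν0) (measure_ne_top _ _), sub_add_cancel]
  have hBm : Measurable fun t => ν univ ^ (p - 1) * ∫⁻ s, Φ (t - s) ^ p ∂ν :=
    (Measurable.lintegral_prod_right' (hsub.pow_const p)).const_mul _
  have hB : ∫⁻ t, ν univ ^ (p - 1) * ∫⁻ s, Φ (t - s) ^ p ∂ν = ν univ ^ p * ∫⁻ t, Φ t ^ p := by
    rw [lintegral_const_mul _ (Measurable.lintegral_prod_right' (hsub.pow_const p)),
      lintegral_lintegral_swap (hsub.pow_const p).aemeasurable]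
    have : ∀ s, ∫⁻ t, Φ (t - s) ^ p = ∫⁻ t, Φ t ^ p := fun s =>
      lintegral_sub_right_eq_self (fun t => Φ t ^ p) s
    simp only [this, lintegral_const]
    rw [mul_comm (∫⁻ t, Φ t ^ p), ← mul_assoc]
    rw [hpow]
  have hBfin : ∫⁻ t, ν univ ^ (p - 1) * ∫⁻ s, Φ (t - s) ^ p ∂ν ≠ ⊤ := by
    rw [hB]
    exact ENNReal.mul_ne_top (ENNReal.rpow_ne_top_of_nonneg hp0.le (measure_ne_top _ _)) h1
  have hνp : ν univ ^ (p - 1) ≠ 0 := by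
    rw [Ne, ENNReal.rpow_eq_zero_iff]
    simp [hν0, measure_ne_top]
  have hJ : ∀ᵐ t, (∀ᵐ s ∂ν, Φ (t - s) = (∫⁻ r, Φ (t - r) ∂ν) / ν univ) ∨
      (∫⁻ s, Φ (t - s) ∂ν) ^ p < ν univ ^ (p - 1) * ∫⁻ s, Φ (t - s) ^ p ∂ν := by
    filter_upwards [ae_lt_top hBm hBfin] with t ht
    refine ae_eq_const_or_lintegral_rpow_lt hν0 hp (hφ.comp (measurable_const.sub measurable_id))
      (fun s => hφ0 _) fun h => ?_
    change ∫⁻ s, Φ (t - s) ^ p ∂ν = ⊤ at h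
    simp [h, ENNReal.mul_top hνp] at ht
  have hle : (fun t => (∫⁻ s, Φ (t - s) ∂ν) ^ p) ≤ᵐ[volume]
      fun t => ν univ ^ (p - 1) * ∫⁻ s, Φ (t - s) ^ p ∂ν := by
    filter_upwards [hJ] with t ht
    rcases ht with ht | ht
    · have : ∫⁻ s, Φ (t - s) ^ p ∂ν = ((∫⁻ r, Φ (t - r) ∂ν) / ν univ) ^ p * ν univ := by
        rw [← lintegral_const]
        refine lintegral_congr_ae ?_
        filter_upwards [ht] with s hs
        rw [hs]
      rw [this, ENNReal.div_rpow_of_nonneg _ _ hp0.le, mul_left_comm, hpow, ENNReal.div_mul_cancel]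
      · simp [ENNReal.rpow_eq_zero_iff, hν0, measure_ne_top]
      · exact ENNReal.rpow_ne_top_of_nonneg hp0.le (measure_ne_top _ _)
    · exact ht.le
  rw [← hB]
  by_contra hcon
  have heq := ae_eq_of_ae_le_of_lintegral_le hle
    (ne_top_of_le_ne_top hBfin (lintegral_mono_ae hle)) hBm.aemeasurable (not_lt.1 hcon)
  have hconst : ∀ᵐ t, ∀ᵐ s ∂ν, Φ (t - s) = (∫⁻ r, Φ (t - r) ∂ν) / ν univ := by
    filter_upwards [hJ, heq] with t ht he
    exact ht.resolve_right fun h => h.ne he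
  rw [Measure.ae_ae_comm
    (p := fun t s => Φ (t - s) = (∫⁻ r, Φ (t - r) ∂ν) / ν univ) (measurableSet_eq_fun hsub
    (((Measurable.lintegral_prod_right' hsub).div_const _).comp measurable_fst))] at hconst
  have : (ae ν).NeBot := ae_neBot.2 hν0
  obtain ⟨s₁, hs₁⟩ := hconst.exists
  have hsing : ∀ᵐ s ∂ν, s ≠ s₁ := by
    rw [ae_iff]
    simp
  obtain ⟨s₂, hs₂, hne⟩ := (hconst.and hsing).exists
  have hper : ∀ a b : ℝ, (∀ᵐ t, Φ (t - a) = Φ (t - b)) → a < b → False := by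
    intro a b hab hlt
    refine h0 (lintegral_eq_zero_of_ae_periodic_s10 h1 (sub_pos.2 hlt) ?_)
    have hqmp := (measurePreserving_add_right (volume : Measure ℝ) a).quasiMeasurePreserving
    filter_upwards [hqmp.ae hab] with t ht
    rw [add_sub_cancel_right] at ht
    change Φ (t - (b - a)) ^ p = Φ t ^ p
    rw [ht, sub_sub_eq_add_sub]
  have h12 : ∀ᵐ t, Φ (t - s₁) = Φ (t - s₂) := by
    filter_upwards [hs₁, hs₂] with t h1 h2
    rw [h1, h2]
  rcases lt_or_gt_of_ne hne with h | h
  · exact hper s₂ s₁ (h12.mono fun t ht => ht.symm) h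
  · exact hper s₁ s₂ h12 h

/-- Exponential substitution in an integral over `(0, ∞)`. -/
theorem lintegral_Ioi_zero_eq_lintegral_exp (g : ℝ → ENNReal) :
    ∫⁻ x in Ioi (0 : ℝ), g x = ∫⁻ t, ENNReal.ofReal (Real.exp t) * g (Real.exp t) := by
  rw [← Real.range_exp, ← image_univ, lintegral_image_eq_lintegral_abs_deriv_mul MeasurableSet.univ
    (fun x _ => (Real.hasDerivAt_exp x).hasDerivWithinAt) Real.exp_injective.injOn,
    setLIntegral_univ]
  simp only [Real.abs_exp]

open MeasureTheory Set

/-- Equivalent strict form with homogeneous kernel of degree `-λ`: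
`∫₀^∞ y^{pσ-1} (∫₀^∞ k_λ(x,y) f(x) dx)^p dy < k_λ(σ)^p ∫₀^∞ x^{p(1-μ)-1} f(x)^p dx`. -/
theorem stmt10 (p q lam mu σ : ℝ) (hp : 1 < p) (hpq : 1 / p + 1 / q = 1)
    (hms : mu + σ = lam)
    (k : ℝ → ℝ → ℝ) (hkm : Measurable (Function.uncurry k))
    (hk0 : ∀ x y : ℝ, 0 < x → 0 < y → 0 ≤ k x y)
    (hhom : ∀ t x y : ℝ, 0 < t → 0 < x → 0 < y → k (t * x) (t * y) = t ^ (-lam) * k x y)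
    (hK0 : 0 < ∫⁻ t in Ioi (0 : ℝ), ENNReal.ofReal (k 1 t * t ^ (σ - 1)))
    (hK1 : (∫⁻ t in Ioi (0 : ℝ), ENNReal.ofReal (k 1 t * t ^ (σ - 1))) < ⊤)
    (f : ℝ → ℝ) (hf : Measurable f) (hf0 : ∀ x ∈ Ioi (0 : ℝ), 0 ≤ f x)
    (hA0 : 0 < ∫⁻ x in Ioi (0 : ℝ), ENNReal.ofReal (x ^ (p * (1 - mu) - 1) * f x ^ p))
    (hA1 : (∫⁻ x in Ioi (0 : ℝ), ENNReal.ofReal (x ^ (p * (1 - mu) - 1) * f x ^ p)) < ⊤) :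
    (∫⁻ y in Ioi (0 : ℝ),
        ENNReal.ofReal (y ^ (p * σ - 1)) *
          (∫⁻ x in Ioi (0 : ℝ), ENNReal.ofReal (k x y * f x)) ^ p)
      < (∫⁻ t in Ioi (0 : ℝ), ENNReal.ofReal (k 1 t * t ^ (σ - 1))) ^ p *
          ∫⁻ x in Ioi (0 : ℝ), ENNReal.ofReal (x ^ (p * (1 - mu) - 1) * f x ^ p) := by
  have hp0 : 0 < p := by linarith
  have hexp : ∀ s a : ℝ, Real.exp s ^ a = Real.exp (s * a) := fun s a => (Real.exp_mul s a).symm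
  set w : ℝ → ENNReal := fun s => ENNReal.ofReal (k 1 (Real.exp s) * Real.exp (s * σ))
  set φ : ℝ → ℝ := fun t => Real.exp ((1 - mu) * t) * f (Real.exp t) with hφdef
  have hw : Measurable w := by
    have : Measurable fun s => k 1 (Real.exp s) :=
      hkm.comp (measurable_const.prodMk Real.measurable_exp)
    fun_prop
  have hφ : Measurable φ := by fun_prop
  have hφ0 : ∀ t, 0 ≤ φ t := fun t => mul_nonneg (Real.exp_pos _).le (hf0 _ (Real.exp_pos t))
  have hK : ∫⁻ t in Ioi (0 : ℝ), ENNReal.ofReal (k 1 t * t ^ (σ - 1)) = ∫⁻ s, w s := by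
    rw [lintegral_Ioi_zero_eq_lintegral_exp]
    refine lintegral_congr fun s => ?_
    rw [← ENNReal.ofReal_mul (Real.exp_pos s).le, hexp, mul_left_comm, ← Real.exp_add]
    congr 3
    ring
  have hA : ∫⁻ x in Ioi (0 : ℝ), ENNReal.ofReal (x ^ (p * (1 - mu) - 1) * f x ^ p) =
      ∫⁻ t, ENNReal.ofReal (φ t) ^ p := by
    rw [lintegral_Ioi_zero_eq_lintegral_exp]
    refine lintegral_congr fun t => ?_
    rw [ENNReal.ofReal_rpow_of_nonneg (hφ0 t) hp0.le, ← ENNReal.ofReal_mul (Real.exp_pos t).le,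
      hexp, Real.mul_rpow (Real.exp_pos _).le (hf0 _ (Real.exp_pos t)), hexp, ← mul_assoc,
      ← Real.exp_add]
    congr 3
    ring
  have hinner : ∀ t : ℝ, ∫⁻ x in Ioi (0 : ℝ), ENNReal.ofReal (k x (Real.exp t) * f x) =
      ENNReal.ofReal (Real.exp (-(σ * t))) * ∫⁻ s, w s * ENNReal.ofReal (φ (t - s)) := by
    intro t
    rw [lintegral_Ioi_zero_eq_lintegral_exp, ← lintegral_sub_left_eq_self _ t,
      ← lintegral_const_mul _ (by fun_prop)]
    refine lintegral_congr fun s => ?_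
    have hk : k (Real.exp (t - s)) (Real.exp t) =
        Real.exp ((t - s) * -lam) * k 1 (Real.exp s) := by
      have h := hhom (Real.exp (t - s)) 1 (Real.exp s) (Real.exp_pos _) one_pos (Real.exp_pos _)
      rwa [mul_one, ← Real.exp_add, sub_add_cancel, hexp] at h
    rw [hk, ← ENNReal.ofReal_mul (Real.exp_pos _).le, ← ENNReal.ofReal_mul
      (mul_nonneg (hk0 _ _ one_pos (Real.exp_pos _)) (Real.exp_pos _).le),
      ← ENNReal.ofReal_mul (Real.exp_pos _).le]
    congr 1
    have he : Real.exp (t - s) * Real.exp ((t - s) * -lam) =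
        Real.exp (-(σ * t)) * Real.exp (s * σ) * Real.exp ((1 - mu) * (t - s)) := by
      rw [← Real.exp_add, ← Real.exp_add, ← Real.exp_add, ← hms]
      congr 1
      ring
    simp only [hφdef]
    linear_combination (k 1 (Real.exp s) * f (Real.exp (t - s))) * he
  have hL : ∫⁻ y in Ioi (0 : ℝ), ENNReal.ofReal (y ^ (p * σ - 1)) *
      (∫⁻ x in Ioi (0 : ℝ), ENNReal.ofReal (k x y * f x)) ^ p =
      ∫⁻ t, (∫⁻ s, w s * ENNReal.ofReal (φ (t - s))) ^ p := by
    rw [lintegral_Ioi_zero_eq_lintegral_exp]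
    refine lintegral_congr fun t => ?_
    rw [hinner, ENNReal.mul_rpow_of_nonneg _ _ hp0.le,
      ENNReal.ofReal_rpow_of_nonneg (Real.exp_pos _).le hp0.le, hexp, hexp, ← mul_assoc,
      ← mul_assoc, ← ENNReal.ofReal_mul (Real.exp_pos _).le, ← Real.exp_add,
      ← ENNReal.ofReal_mul (Real.exp_pos _).le, ← Real.exp_add,
      show t + t * (p * σ - 1) + -(σ * t) * p = 0 by ring, Real.exp_zero, ENNReal.ofReal_one,
      one_mul]
  rw [hK] at hK0 hK1
  rw [hA] at hA0 hA1
  rw [hL, hK, hA]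
  exact lintegral_convolution_rpow_lt hp hw hφ hφ0 hK0.ne' hK1.ne hA0.ne' hA1.ne
end
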